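/- For all s ∈ [0,1]³ and all n ≥ 1: Π_{k=1}^{n} [ first component of f_k( (f_{k+1} ∘ ⋯ ∘ f_n)(s) ) ] = 1 / (1 + Σ_{j=1}^{n} e_1 (A_j A_{j+1} ⋯ A_n)(1 − s)), where for k = n the inner composition is the identity, 1 = (1,1,1)^T, and e_1 is the first standard basis row vector. Consequently this product is a linear fractional function of s of the form (1/S_n) / (1 − (S_n^1/S_n)s_1 − (S_n^2/S_n)s_2 − (S_n^3/S_n)s_3), with S_n^i = Σ_{j=1}^{n} e_1 (A_j ⋯ A_n) e_i^T and S_n = 1 + S_n^1 + S_n^2 + S_n^3. -/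

import Mathlib

open Matrix

/-- The linear fractional map `f_k(s) = 1 - A_k(1-s)/(1 + e₁ A_k (1-s))`. -/
noncomputable def fStep (A : ℕ → Matrix (Fin 3) (Fin 3) ℝ) (k : ℕ) (s : Fin 3 → ℝ) :
    Fin 3 → ℝ :=
  fun i => 1 - (A k *ᵥ fun j => 1 - s j) i / (1 + (A k *ᵥ fun j => 1 - s j) 0)

/-- The composition `f_k ∘ f_{k+1} ∘ ⋯ ∘ f_n` (the identity when `k > n`). -/
noncomputable def fComp (A : ℕ → Matrix (Fin 3) (Fin 3) ℝ) (k n : ℕ) (s : Fin 3 → ℝ) :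
    Fin 3 → ℝ :=
  (List.range' k (n + 1 - k)).foldr (fun j v => fStep A j v) s

/-- The ordered matrix product `A_k A_{k+1} ⋯ A_n` (the identity when `k > n`). -/
noncomputable def prodMat (A : ℕ → Matrix (Fin 3) (Fin 3) ℝ) (k n : ℕ) :
    Matrix (Fin 3) (Fin 3) ℝ :=
  ((List.range' k (n + 1 - k)).map A).prod

lemma fComp_eq_fStep (A : ℕ → Matrix (Fin 3) (Fin 3) ℝ) {k n : ℕ} (h : k ≤ n) (s : Fin 3 → ℝ) :
    fComp A k n s = fStep A k (fComp A (k + 1) n s) := by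
  have e : n + 1 - k = (n + 1 - (k + 1)) + 1 := by omega
  rw [fComp, e, List.range'_succ, List.foldr_cons, fComp]

lemma fComp_of_lt (A : ℕ → Matrix (Fin 3) (Fin 3) ℝ) {k n : ℕ} (h : n < k) (s : Fin 3 → ℝ) :
    fComp A k n s = s := by
  have e : n + 1 - k = 0 := by omega
  simp [fComp, e]

lemma prodMat_eq_mul (A : ℕ → Matrix (Fin 3) (Fin 3) ℝ) {k n : ℕ} (h : k ≤ n) :
    prodMat A k n = A k * prodMat A (k + 1) n := by
  have e : n + 1 - k = (n + 1 - (k + 1)) + 1 := by omega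
  rw [prodMat, e, List.range'_succ, List.map_cons, List.prod_cons, prodMat]

lemma prodMat_of_lt (A : ℕ → Matrix (Fin 3) (Fin 3) ℝ) {k n : ℕ} (h : n < k) :
    prodMat A k n = 1 := by
  have e : n + 1 - k = 0 := by omega
  simp [prodMat, e]

lemma prodMat_nonneg {A : ℕ → Matrix (Fin 3) (Fin 3) ℝ} (hA : ∀ k i j, 0 ≤ A k i j)
    (k n : ℕ) (i j : Fin 3) : 0 ≤ prodMat A k n i j := by
  unfold prodMat
  induction List.range' k (n + 1 - k) generalizing i j with
  | nil =>
    rw [List.map_nil, List.prod_nil, Matrix.one_apply]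
    split_ifs <;> norm_num
  | cons a l ih =>
    rw [List.map_cons, List.prod_cons, Matrix.mul_apply]
    exact Finset.sum_nonneg fun x _ => mul_nonneg (hA a i x) (ih x j)

/-- The denominator `1 + ∑_{j=k}^n e₁ (A_j ⋯ A_n) v`. -/
noncomputable def fracDenom (A : ℕ → Matrix (Fin 3) (Fin 3) ℝ) (k n : ℕ) (v : Fin 3 → ℝ) : ℝ :=
  1 + ∑ j ∈ Finset.Icc k n, (prodMat A j n *ᵥ v) 0

lemma fracDenom_pos {A : ℕ → Matrix (Fin 3) (Fin 3) ℝ} (hA : ∀ k i j, 0 ≤ A k i j)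
    {v : Fin 3 → ℝ} (hv : ∀ i, 0 ≤ v i) (k n : ℕ) : 0 < fracDenom A k n v :=
  add_pos_of_pos_of_nonneg one_pos <| Finset.sum_nonneg fun j _ =>
    dotProduct_nonneg_of_nonneg (prodMat_nonneg hA j n 0) hv

lemma fracDenom_eq_add (A : ℕ → Matrix (Fin 3) (Fin 3) ℝ) {k n : ℕ} (h : k ≤ n)
    (v : Fin 3 → ℝ) :
    fracDenom A k n v = fracDenom A (k + 1) n v + (prodMat A k n *ᵥ v) 0 := by
  rw [fracDenom, fracDenom, ← Finset.insert_Icc_add_one_left_eq_Icc h,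
    Finset.sum_insert (by simp)]
  ring

/-- If `1 - t = w / X` then `f_k(t) = 1 - A_k w / (X + e₁ A_k w)`. -/
lemma fStep_one_sub_div (A : ℕ → Matrix (Fin 3) (Fin 3) ℝ) (k : ℕ) (w : Fin 3 → ℝ) {X : ℝ}
    (hX : X ≠ 0) (i : Fin 3) :
    fStep A k (fun j => 1 - w j / X) i = 1 - (A k *ᵥ w) i / (X + (A k *ᵥ w) 0) := by
  have e : (fun j => 1 - (1 - w j / X)) = X⁻¹ • w := by
    ext j
    simp [div_eq_inv_mul]
  have e' : 1 + X⁻¹ * (A k *ᵥ w) 0 = X⁻¹ * (X + (A k *ᵥ w) 0) := by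
    field_simp
  simp only [fStep, e, Matrix.mulVec_smul, Pi.smul_apply, smul_eq_mul]
  rw [e', mul_div_mul_left _ _ (inv_ne_zero hX)]

lemma fComp_eq_one_sub_div {A : ℕ → Matrix (Fin 3) (Fin 3) ℝ} (hA : ∀ k i j, 0 ≤ A k i j)
    {s : Fin 3 → ℝ} (hs : ∀ i, s i ≤ 1) {k n : ℕ} (hk : k ≤ n + 1) :
    fComp A k n s = fun i =>
      1 - (prodMat A k n *ᵥ fun j => 1 - s j) i / fracDenom A k n fun j => 1 - s j := by
  induction hk using Nat.decreasingInduction with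
  | self =>
    rw [fComp_of_lt A n.lt_succ_self, prodMat_of_lt A n.lt_succ_self]
    simp [fracDenom]
  | of_succ k hk ih =>
    have hkn : k ≤ n := Nat.lt_succ_iff.mp hk
    have hX := fracDenom_pos hA (fun i => sub_nonneg.mpr (hs i)) (k + 1) n
    ext i
    rw [fComp_eq_fStep A hkn, ih, fStep_one_sub_div A k _ hX.ne', fracDenom_eq_add A hkn,
      prodMat_eq_mul A hkn, Matrix.mulVec_mulVec]

lemma prod_fStep_fComp {A : ℕ → Matrix (Fin 3) (Fin 3) ℝ} (hA : ∀ k i j, 0 ≤ A k i j)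
    {s : Fin 3 → ℝ} (hs : ∀ i, s i ≤ 1) {k n : ℕ} (hk : k ≤ n + 1) :
    ∏ j ∈ Finset.Icc k n, fStep A j (fComp A (j + 1) n s) 0
      = 1 / fracDenom A k n fun j => 1 - s j := by
  induction hk using Nat.decreasingInduction with
  | self => simp [fracDenom]
  | of_succ k hk ih =>
    have hkn : k ≤ n := Nat.lt_succ_iff.mp hk
    have hv : ∀ i, 0 ≤ 1 - s i := fun i => sub_nonneg.mpr (hs i)
    have hX := fracDenom_pos hA hv (k + 1) n
    have hY := fracDenom_pos hA hv k n
    have hadd := fracDenom_eq_add A hkn fun j => 1 - s j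
    rw [← Finset.insert_Icc_add_one_left_eq_Icc hkn, Finset.prod_insert (by simp), ih,
      ← fComp_eq_fStep A hkn, fComp_eq_one_sub_div hA hs hk.le]
    beta_reduce
    rw [one_sub_div hY.ne', sub_eq_of_eq_add hadd]
    field_simp

/-- for `s ∈ [0,1]³` and `n ≥ 1`,
`∏_{k=1}^n [f_k((f_{k+1}∘⋯∘f_n)(s))]₁ = 1/(1 + ∑_{j=1}^n e₁(A_j⋯A_n)(1-s))`, and this
product is the linear fractional function
`(1/S_n)/(1 - (S_n^1/S_n)s₁ - (S_n^2/S_n)s₂ - (S_n^3/S_n)s₃)` with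
`S_n^i = ∑_{j=1}^n e₁(A_j⋯A_n)e_i^T` and `S_n = 1 + S_n^1 + S_n^2 + S_n^3`. -/
theorem stmt10 (A : ℕ → Matrix (Fin 3) (Fin 3) ℝ) (hA : ∀ k i j, 0 ≤ A k i j)
    (s : Fin 3 → ℝ) (hs : ∀ i, s i ∈ Set.Icc (0 : ℝ) 1) (n : ℕ) (hn : 1 ≤ n)
    (S1 S2 S3 Sn : ℝ)
    (hS1 : S1 = ∑ j ∈ Finset.Icc 1 n, prodMat A j n 0 0)
    (hS2 : S2 = ∑ j ∈ Finset.Icc 1 n, prodMat A j n 0 1)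
    (hS3 : S3 = ∑ j ∈ Finset.Icc 1 n, prodMat A j n 0 2)
    (hSn : Sn = 1 + S1 + S2 + S3) :
    (∏ k ∈ Finset.Icc 1 n, fStep A k (fComp A (k + 1) n s) 0)
      = 1 / (1 + ∑ j ∈ Finset.Icc 1 n, (prodMat A j n *ᵥ fun i => 1 - s i) 0) ∧
    (∏ k ∈ Finset.Icc 1 n, fStep A k (fComp A (k + 1) n s) 0)
      = (1 / Sn) / (1 - (S1 / Sn) * s 0 - (S2 / Sn) * s 1 - (S3 / Sn) * s 2) := by
  have hs1 : ∀ i, s i ≤ 1 := fun i => (hs i).2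
  have hprod := prod_fStep_fComp hA hs1 (Nat.le_add_left 1 n)
  refine ⟨hprod, hprod.trans ?_⟩
  have hpos (i : Fin 3) : 0 ≤ ∑ j ∈ Finset.Icc 1 n, prodMat A j n 0 i :=
    Finset.sum_nonneg fun j _ => prodMat_nonneg hA j n 0 i
  have hSn0 : 0 < Sn := by
    have h1 := hpos 0
    have h2 := hpos 1
    have h3 := hpos 2
    linarith
  have hden : fracDenom A 1 n (fun j => 1 - s j)
      = Sn * (1 - (S1 / Sn) * s 0 - (S2 / Sn) * s 1 - (S3 / Sn) * s 2) := by
    have hD : fracDenom A 1 n (fun j => 1 - s j)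
        = 1 + S1 * (1 - s 0) + S2 * (1 - s 1) + S3 * (1 - s 2) := by
      simp only [fracDenom, Matrix.mulVec, dotProduct, Fin.sum_univ_three,
        Finset.sum_add_distrib, ← Finset.sum_mul, hS1, hS2, hS3]
      ring
    rw [hD]
    field_simp
    rw [hSn]
    ring
  rw [hden, div_div]
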